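/- Let G be a directed graph with dnd-equivalence classes C_1, ..., C_d. For any induced (directed) path p = v_1 ... v_ℓ in G, there is at most one index i such that |C_i ∩ p| > 1, and in that case C_i ∩ p = {v_1, v_ℓ} (the two endpoints of the path). -/

import Mathlib

/-- Directed neighborhood diversity relation. -/
def dndRel {V : Type*} (E : V → V → Prop) (u v : V) : Prop :=
  ({x | E x u} \ {v} : Set V) = {x | E x v} \ {u} ∧
  ({x | E u x} \ {v} : Set V) = {x | E v x} \ {u} ∧
  (E u v ↔ E v u)

/-- An induced directed path: distinct vertices, consecutive arcs, and the only
arcs among its vertices are the consecutive ones. -/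
def IsInducedDipath {V : Type*} (E : V → V → Prop) (p : List V) : Prop :=
  p.Nodup ∧ p.Chain' E ∧
  ∀ i j : Fin p.length, E (p.get i) (p.get j) → (j : ℕ) = (i : ℕ) + 1

theorem dndRel_iff {V : Type*} {E : V → V → Prop} {u v : V} :
    dndRel E u v ↔
      (∀ x, E x u ∧ x ≠ v ↔ E x v ∧ x ≠ u) ∧
      (∀ x, E u x ∧ x ≠ v ↔ E v x ∧ x ≠ u) ∧ (E u v ↔ E v u) := by
  simp only [dndRel, Set.ext_iff, Set.mem_sdiff, Set.mem_ofPred_eq, Set.mem_singleton_iff, ne_eq]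

theorem dndRel.symm {V : Type*} {E : V → V → Prop} {u v : V} (h : dndRel E u v) :
    dndRel E v u :=
  ⟨h.1.symm, h.2.1.symm, h.2.2.symm⟩

theorem dndRel.trans {V : Type*} {E : V → V → Prop} (hloopless : ∀ v, ¬ E v v) {u v w : V}
    (huv : dndRel E u v) (hvw : dndRel E v w) : dndRel E u w := by
  rw [dndRel_iff] at *
  obtain ⟨h₁, h₂, h₃⟩ := huv
  obtain ⟨k₁, k₂, k₃⟩ := hvw
  refine ⟨fun x => ?_, fun x => ?_, ?_⟩ <;> grind

/-- Among the vertices of an induced dipath, the earlier of two dnd-equivalent ones would have a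
successor that the later one must also point to, which is impossible. -/
theorem IsInducedDipath.not_dndRel_of_lt {V : Type*} {E : V → V → Prop} {p : List V}
    (hp : IsInducedDipath E p) {i j : ℕ} (hij : i < j) (hj : j < p.length) :
    ¬ dndRel E p[i] p[j] := by
  intro h
  obtain ⟨hnodup, hchain, hind⟩ := hp
  have hsucc : E p[i] p[i + 1] := List.isChain_iff_getElem.mp hchain i (by lia)
  obtain ⟨-, hout, hswap⟩ := dndRel_iff.mp h
  rcases Nat.eq_or_lt_of_le (Nat.succ_le_of_lt hij) with rfl | hlt
  · have := hind ⟨i + 1, hj⟩ ⟨i, by lia⟩ (hswap.mp hsucc)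
    grind
  · have hne : p[i + 1] ≠ p[j] := fun h => hlt.ne (hnodup.getElem_inj_iff.mp h)
    have := hind ⟨j, hj⟩ ⟨i + 1, by lia⟩ ((hout _).mp ⟨hsucc, hne⟩).1
    grind

theorem IsInducedDipath.eq_of_dndRel {V : Type*} {E : V → V → Prop} {p : List V}
    (hp : IsInducedDipath E p) {u v : V} (hu : u ∈ p) (hv : v ∈ p) (h : dndRel E u v) :
    u = v := by
  obtain ⟨i, hi, rfl⟩ := List.getElem_of_mem hu
  obtain ⟨j, hj, rfl⟩ := List.getElem_of_mem hv
  rcases lt_trichotomy i j with hij | rfl | hij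
  · exact absurd h (hp.not_dndRel_of_lt hij hj)
  · rfl
  · exact absurd h.symm (hp.not_dndRel_of_lt hij hi)

theorem IsInducedDipath.ncard_class_inter_le_one {V : Type*} {E : V → V → Prop}
    (hloopless : ∀ v, ¬ E v v) {p : List V} (hp : IsInducedDipath E p) (v : V) :
    ({u | dndRel E u v} ∩ {x | x ∈ p}).ncard ≤ 1 := by
  rw [Set.ncard_le_one (p.finite_toSet.inter_of_right _)]
  exact fun _ ha _ hb => hp.eq_of_dndRel ha.2 hb.2 (ha.1.trans hloopless hb.1.symm)

/-- For any induced directed path `p`, at most one dnd-class intersects `p` in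
more than one vertex, and in that case the intersection consists exactly of the
two endpoints of `p`. -/
theorem induced_dipath_dnd_classes {V : Type*} (E : V → V → Prop)
    (hloopless : ∀ v, ¬ E v v) (p : List V) (hne : p ≠ [])
    (hp : IsInducedDipath E p) :
    (∀ C D : Set V, (∃ v, C = {u | dndRel E u v}) → (∃ v, D = {u | dndRel E u v}) →
      1 < (C ∩ {x | x ∈ p}).ncard → 1 < (D ∩ {x | x ∈ p}).ncard → C = D) ∧
    (∀ C : Set V, (∃ v, C = {u | dndRel E u v}) → 1 < (C ∩ {x | x ∈ p}).ncard →
      C ∩ {x | x ∈ p} = {p.head hne, p.getLast hne}) := by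
  constructor
  · rintro C D ⟨v, rfl⟩ - hC -
    exact absurd hC (hp.ncard_class_inter_le_one hloopless v).not_gt
  · rintro C ⟨v, rfl⟩ hC
    exact absurd hC (hp.ncard_class_inter_le_one hloopless v).not_gt
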